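/- Assume in addition that d_q ∘ d_q = 0. Then D ∘ D = 0 and F = −E ∘ D; moreover d_q vanishes identically on the submodule d_q(B⊗̂R). -/

import Mathlib

/-!
`B` is a "deformation base": a commutative Noetherian local ℂ-algebra, complete in the
`𝔪`-adic topology, with residue field `ℂ`.  For a ℂ-vector space `X`, the completed
tensor product `B ⊗̂ X` is the `𝔪`-adic completion of `B ⊗[ℂ] X`, realized as the
inverse limit of the modules `(B ⊗[ℂ] X) ⧸ 𝔪^k (B ⊗[ℂ] X) ≅ B/𝔪^k ⊗[ℂ] X`.
-/

open scoped TensorProduct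
open IsLocalRing

/-- The completed tensor product `B ⊗̂ X`. -/
noncomputable abbrev CTP (B : Type) [CommRing B] [Algebra ℂ B] [IsLocalRing B]
    (X : Type) [AddCommGroup X] [Module ℂ X] : Type :=
  AdicCompletion (maximalIdeal B) (B ⊗[ℂ] X)

/-- The canonical embedding `X → B ⊗̂ X`, `x ↦ 1 ⊗ x`. -/
noncomputable def iota (B : Type) [CommRing B] [Algebra ℂ B] [IsLocalRing B]
    (X : Type) [AddCommGroup X] [Module ℂ X] (x : X) : CTP B X :=
  AdicCompletion.of (maximalIdeal B) (B ⊗[ℂ] X) ((1 : B) ⊗ₜ x)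

/-- The submodule `𝔪^k X ⊆ B ⊗̂ X`: the kernel of the canonical projection
`B ⊗̂ X → (B ⊗[ℂ] X) ⧸ 𝔪^k (B ⊗[ℂ] X) ≅ B/𝔪^k ⊗[ℂ] X`. -/
noncomputable def mpow (B : Type) [CommRing B] [Algebra ℂ B] [IsLocalRing B]
    (X : Type) [AddCommGroup X] [Module ℂ X] (k : ℕ) : Submodule B (CTP B X) :=
  LinearMap.ker (AdicCompletion.eval (maximalIdeal B) (B ⊗[ℂ] X) k)

/-- The `𝔪`-adic topology on `B ⊗̂ X`, generated by the cosets `x + 𝔪^k X`. -/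
noncomputable def adicTop (B : Type) [CommRing B] [Algebra ℂ B] [IsLocalRing B]
    (X : Type) [AddCommGroup X] [Module ℂ X] : TopologicalSpace (CTP B X) :=
  TopologicalSpace.generateFrom
    {s | ∃ (x : CTP B X) (k : ℕ), s = {y | y - x ∈ mpow B X k}}

/-- For a ℂ-subspace `W ⊆ V`, the `B`-submodule `B ⊗̂ W ⊆ B ⊗̂ V`: those elements all of
whose finite-level components `(B ⊗[ℂ] V) ⧸ 𝔪^n (B ⊗[ℂ] V)` come from `B ⊗[ℂ] W`. -/
noncomputable def csub (B : Type) [CommRing B] [Algebra ℂ B] [IsLocalRing B]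
    (V : Type) [AddCommGroup V] [Module ℂ V] (W : Submodule ℂ V) :
    Submodule B (CTP B V) :=
  ⨅ n : ℕ, Submodule.comap
    (AdicCompletion.eval (maximalIdeal B) (B ⊗[ℂ] V) n)
    (LinearMap.range ((Submodule.mkQ ((maximalIdeal B) ^ n • ⊤)).comp
      ((W.subtype).baseChange B)))

/-- The `B`-linear extension `B ⊗̂ X → B ⊗̂ Y` of a `ℂ`-linear map `X → Y`. -/
noncomputable def completedMap (B : Type) [CommRing B] [Algebra ℂ B] [IsLocalRing B]
    {X Y : Type} [AddCommGroup X] [Module ℂ X] [AddCommGroup Y] [Module ℂ Y]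
    (f : X →ₗ[ℂ] Y) : CTP B X →ₗ[B] CTP B Y :=
  (AdicCompletion.map (maximalIdeal B) (f.baseChange B)).restrictScalars B

section

variable {B : Type} [CommRing B] [Algebra ℂ B] [IsLocalRing B]
  {X Y Z : Type} [AddCommGroup X] [Module ℂ X] [AddCommGroup Y] [Module ℂ Y]
  [AddCommGroup Z] [Module ℂ Z]

theorem completedMap_of (f : X →ₗ[ℂ] Y) (x : B ⊗[ℂ] X) :
    completedMap B f (AdicCompletion.of (maximalIdeal B) (B ⊗[ℂ] X) x) =
      AdicCompletion.of (maximalIdeal B) (B ⊗[ℂ] Y) (f.baseChange B x) :=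
  rfl

theorem completedMap_completedMap (f : X →ₗ[ℂ] Y) (g : Y →ₗ[ℂ] Z) (x : CTP B X) :
    completedMap B g (completedMap B f x) = completedMap B (g ∘ₗ f) x := by
  simp only [completedMap, LinearMap.coe_restrictScalars, AdicCompletion.map_comp_apply,
    LinearMap.baseChange_comp]

theorem completedMap_id (x : CTP B X) : completedMap B LinearMap.id x = x := by
  simp [completedMap]

theorem completedMap_zero (x : CTP B X) : completedMap B (0 : X →ₗ[ℂ] Y) x = 0 := by
  simp [completedMap]

theorem completedMap_congr {W : Submodule ℂ X} {f g : X →ₗ[ℂ] Y} (hfg : ∀ w ∈ W, f w = g w)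
    {x : CTP B X} (hx : x ∈ csub B X W) : completedMap B f x = completedMap B g x := by
  have hcomp : f ∘ₗ W.subtype = g ∘ₗ W.subtype := LinearMap.ext fun w => hfg w w.2
  refine AdicCompletion.ext fun n => ?_
  obtain ⟨t, ht⟩ := (Submodule.mem_iInf _).mp hx n
  change _ = x.val n at ht
  simp only [completedMap, LinearMap.coe_restrictScalars, AdicCompletion.map_val_apply, ← ht]
  change Submodule.Quotient.mk (f.baseChange B (W.subtype.baseChange B t)) =
    Submodule.Quotient.mk (g.baseChange B (W.subtype.baseChange B t))
  rw [← LinearMap.comp_apply, ← LinearMap.comp_apply, ← LinearMap.baseChange_comp,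
    ← LinearMap.baseChange_comp, hcomp]

theorem completedMap_eq_self {W : Submodule ℂ X} {f : X →ₗ[ℂ] X} (hf : ∀ w ∈ W, f w = w)
    {x : CTP B X} (hx : x ∈ csub B X W) : completedMap B f x = x := by
  rw [completedMap_congr (g := LinearMap.id) hf hx, completedMap_id]

theorem completedMap_eq_zero {W : Submodule ℂ X} {f : X →ₗ[ℂ] Y} (hf : ∀ w ∈ W, f w = 0)
    {x : CTP B X} (hx : x ∈ csub B X W) : completedMap B f x = 0 := by
  rw [completedMap_congr (g := 0) hf hx, completedMap_zero]

theorem eq_zero_of_forall_mem_mpow {x : CTP B X} (hx : ∀ k, x ∈ mpow B X k) : x = 0 :=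
  AdicCompletion.ext hx

theorem mem_mpow_zero (x : CTP B X) : x ∈ mpow B X 0 := by
  refine AdicCompletion.pow_smul_top_le_ker_eval (I := maximalIdeal B) 0 ?_
  simp

variable [IsNoetherianRing B]

theorem mpow_eq_pow_smul_top (k : ℕ) :
    mpow B X k = (maximalIdeal B) ^ k • (⊤ : Submodule B (CTP B X)) :=
  (AdicCompletion.pow_smul_top_eq_ker_eval
    ((isNoetherianRing_iff_ideal_fg B).mp inferInstance _)).symm

theorem map_mem_mpow_add {φ : CTP B X →ₗ[B] CTP B Y} {j : ℕ} (hφ : ∀ x, φ x ∈ mpow B Y j)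
    {k : ℕ} {x : CTP B X} (hx : x ∈ mpow B X k) : φ x ∈ mpow B Y (k + j) := by
  rw [mpow_eq_pow_smul_top] at hx
  have hmap := Submodule.mem_map_of_mem (f := φ) hx
  rw [Submodule.map_smul''] at hmap
  rw [mpow_eq_pow_smul_top, pow_add, Submodule.mul_smul, ← mpow_eq_pow_smul_top]
  refine Submodule.smul_mono le_rfl ?_ hmap
  rintro _ ⟨y, -, rfl⟩
  exact hφ y

theorem map_mem_mpow (φ : CTP B X →ₗ[B] CTP B Y)
    {k : ℕ} {x : CTP B X} (hx : x ∈ mpow B X k) : φ x ∈ mpow B Y k :=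
  map_mem_mpow_add (j := 0) (fun x => mem_mpow_zero (φ x)) hx

/-- A `B`-linear map agrees with the extension of its leading term to first order. -/
theorem sub_completedMap_mem_mpow_one {φ : CTP B X →ₗ[B] CTP B Y} {f : X →ₗ[ℂ] Y}
    (hlead : ∀ v : X, φ (iota B X v) - iota B Y (f v) ∈ mpow B Y 1) (x : CTP B X) :
    (φ - completedMap B f) x ∈ mpow B Y 1 := by
  have hof (t : B ⊗[ℂ] X) : (φ - completedMap B f)
      (AdicCompletion.of (maximalIdeal B) (B ⊗[ℂ] X) t) ∈ mpow B Y 1 := by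
    induction t with
    | zero => simp
    | add s t hs ht => simpa only [map_add] using add_mem hs ht
    | tmul b v =>
      have hbv : b ⊗ₜ[ℂ] v = b • ((1 : B) ⊗ₜ[ℂ] v) := by simp [TensorProduct.smul_tmul']
      rw [hbv, map_smul, map_smul]
      refine Submodule.smul_mem _ b ?_
      simpa [completedMap_of, iota] using hlead v
  obtain ⟨t, ht⟩ := Submodule.mkQ_surjective _
    (AdicCompletion.eval (maximalIdeal B) (B ⊗[ℂ] X) 1 x)
  have hdiff : x - AdicCompletion.of (maximalIdeal B) (B ⊗[ℂ] X) t ∈ mpow B X 1 := by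
    rw [mpow, LinearMap.mem_ker, map_sub, AdicCompletion.eval_of, ht, sub_self]
  have hadd := add_mem (map_mem_mpow (φ - completedMap B f) hdiff) (hof t)
  rwa [← map_add, sub_add_cancel] at hadd

/-- The sum `(B ⊗̂ H) + φ (B ⊗̂ R) + (B ⊗̂ R)` is direct, and `φ` is injective on `B ⊗̂ R`,
whenever the leading term of `φ` is the differential of a homological splitting. -/
theorem eq_zero_of_add_map_add_eq_zero {H I R : Submodule ℂ X} {d : X →ₗ[ℂ] X}
    (hsup : H ⊔ I ⊔ R = ⊤) (hdisjH : Disjoint H (I ⊔ R)) (hdisjIR : Disjoint I R)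
    (hI : I = LinearMap.range d) (hker : LinearMap.ker d = H ⊔ I)
    {φ : CTP B X →ₗ[B] CTP B X}
    (hlead : ∀ v : X, φ (iota B X v) - iota B X (d v) ∈ mpow B X 1)
    {a r s : CTP B X} (ha : a ∈ csub B X H) (hr : r ∈ csub B X R) (hs : s ∈ csub B X R)
    (h : a + φ r + s = 0) : a = 0 ∧ r = 0 ∧ s = 0 := by
  have hcH : IsCompl H (I ⊔ R) :=
    ⟨hdisjH, codisjoint_iff.mpr (by rw [← sup_assoc, hsup])⟩
  have hcR : IsCompl R (H ⊔ I) :=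
    ⟨(hdisjIR.disjoint_sup_left_of_disjoint_sup_right hdisjH).symm,
      codisjoint_iff.mpr (by rw [sup_comm, hsup])⟩
  have hdI (v : X) : d v ∈ I := hI ▸ LinearMap.mem_range_self d v
  let pH := H.projection (I ⊔ R) hcH
  let pR := R.projection (H ⊔ I) hcR
  obtain ⟨g, hg⟩ := (d ∘ₗ R.subtype).exists_leftInverse_of_injective (by
    rw [LinearMap.ker_comp, hker, ← Submodule.disjoint_iff_comap_eq_bot]
    exact hcR.disjoint)
  have pH_H : completedMap B pH a = a :=
    completedMap_eq_self (fun w hw => Submodule.projection_apply_left hcH ⟨w, hw⟩) ha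
  have pH_R : completedMap B pH s = 0 :=
    completedMap_eq_zero (fun w hw => (Submodule.projection_apply_eq_zero_iff hcH).mpr
      (Submodule.mem_sup_right hw)) hs
  have pH_d : completedMap B pH (completedMap B d r) = 0 := by
    rw [completedMap_completedMap]
    refine completedMap_eq_zero (fun w _ => ?_) hr
    exact (Submodule.projection_apply_eq_zero_iff hcH).mpr (Submodule.mem_sup_left (hdI w))
  have pR_R : completedMap B pR s = s :=
    completedMap_eq_self (fun w hw => Submodule.projection_apply_left hcR ⟨w, hw⟩) hs
  have pR_H : completedMap B pR a = 0 :=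
    completedMap_eq_zero (fun w hw => (Submodule.projection_apply_eq_zero_iff hcR).mpr
      (Submodule.mem_sup_left hw)) ha
  have pR_d : completedMap B pR (completedMap B d r) = 0 := by
    rw [completedMap_completedMap]
    refine completedMap_eq_zero (fun w _ => ?_) hr
    exact (Submodule.projection_apply_eq_zero_iff hcR).mpr (Submodule.mem_sup_right (hdI w))
  have g_d : completedMap B (R.subtype ∘ₗ g) (completedMap B d r) = r := by
    rw [completedMap_completedMap]
    exact completedMap_eq_self
      (fun w hw => congrArg Subtype.val (LinearMap.congr_fun hg ⟨w, hw⟩)) hr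
  have hr_mem (k : ℕ) : r ∈ mpow B X k := by
    induction k with
    | zero => exact mem_mpow_zero r
    | succ k ih =>
      have hlow := map_mem_mpow_add (sub_completedMap_mem_mpow_one hlead) ih
      have hsum : a + completedMap B d r + s ∈ mpow B X (k + 1) := by
        have heq : a + completedMap B d r + s = -((φ - completedMap B d) r) := by
          rw [LinearMap.sub_apply, ← sub_eq_zero, ← h]
          abel
        exact heq ▸ neg_mem hlow
      have ha' : a ∈ mpow B X (k + 1) := by
        simpa [pH_H, pH_R, pH_d] using map_mem_mpow (completedMap B pH) hsum
      have hs' : s ∈ mpow B X (k + 1) := by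
        simpa [pR_H, pR_R, pR_d] using map_mem_mpow (completedMap B pR) hsum
      have hd' : completedMap B d r ∈ mpow B X (k + 1) := by
        simpa using sub_mem (sub_mem hsum hs') ha'
      exact g_d ▸ map_mem_mpow (completedMap B (R.subtype ∘ₗ g)) hd'
  have hr0 : r = 0 := eq_zero_of_forall_mem_mpow hr_mem
  have has : a + s = 0 := by simpa [hr0] using h
  have ha0 : a = 0 := by
    simpa [pH_H, pH_R] using congrArg (completedMap B pH) has
  exact ⟨ha0, hr0, by simpa [ha0] using has⟩

end

/-- If moreover `d_q ∘ d_q = 0`, then `D ∘ D = 0` and `F = -E ∘ D`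
(as operators on `B ⊗̂ H`), and `d_q` vanishes identically on `d_q(B ⊗̂ R)`. -/
theorem D_squared_zero_and_F_eq_neg_ED
    (B : Type) [CommRing B] [Algebra ℂ B] [IsNoetherianRing B] [IsLocalRing B]
    [IsAdicComplete (maximalIdeal B) B]
    (hres : Function.Bijective (algebraMap ℂ (ResidueField B)))
    (V : Type) [AddCommGroup V] [Module ℂ V]
    (H I R : Submodule ℂ V) (d : V →ₗ[ℂ] V)
    (hsup : H ⊔ I ⊔ R = ⊤)
    (hdisjH : Disjoint H (I ⊔ R)) (hdisjIR : Disjoint I R)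
    (hI : I = LinearMap.range d)
    (hker : LinearMap.ker d = H ⊔ I)
    (dq : CTP B V →ₗ[B] CTP B V)
    (hlead : ∀ v : V, dq (iota B V v) - iota B V (d v) ∈ mpow B V 1)
    (D E F : CTP B V →ₗ[B] CTP B V)
    (hD : ∀ h ∈ csub B V H, D h ∈ csub B V H)
    (hE : ∀ h ∈ csub B V H, E h ∈ csub B V R)
    (hF : ∀ h ∈ csub B V H, F h ∈ csub B V R)
    (hDEF : ∀ h ∈ csub B V H, dq h = D h + dq (E h) + F h)
    (hdq2 : ∀ x : CTP B V, dq (dq x) = 0) :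
    (∀ h ∈ csub B V H, D (D h) = 0) ∧
    (∀ h ∈ csub B V H, F h = - E (D h)) ∧
    (∀ x ∈ Submodule.map dq (csub B V R), dq x = 0) := by
  refine ⟨fun h hh => ?_, fun h hh => ?_, ?_⟩
  rotate_left 2
  · rintro _ ⟨y, -, rfl⟩
    exact hdq2 y
  all_goals
    have hDh := hD h hh
    have hsum : D (D h) + dq (E (D h) + F h) + F (D h) = 0 := by
      have hsq := congrArg dq (hDEF h hh)
      rw [hdq2, map_add, map_add, hdq2, hDEF (D h) hDh] at hsq
      rw [map_add, hsq]
      abel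
    obtain ⟨hDD, hEF, -⟩ := eq_zero_of_add_map_add_eq_zero hsup hdisjH hdisjIR hI hker hlead
      (hD _ hDh) (add_mem (hE _ hDh) (hF h hh)) (hF _ hDh) hsum
  · exact hDD
  · exact eq_neg_of_add_eq_zero_right hEF
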